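/- The maximal entanglement of formation between two sites of a globally symmetric multipartite state equals minus the infimum of ground state energies of the corresponding group-averaged nearest-neighbor Hamiltonians. Precisely: let n ≥ 2 and d ≥ 1 be natural numbers, G a subgroup of Equiv.Perm (Fin n), and for g ∈ G let U_g be the unitary on Matrix (Fin n → Fin d) (Fin n → Fin d) ℂ permuting the tensor factors of (ℂ^d)^{⊗n}, i.e. (U_g)(f, f') = 1 if f = f' ∘ g⁻¹ and 0 otherwise. For a Hermitian h ∈ Matrix ((Fin d) × (Fin d)) ((Fin d) × (Fin d)) ℂ let h⊗1 be the matrix on (Fin n → Fin d) with entries (h⊗1)(f, f') = h((f 0, f 1), (f' 0, f' 1)) if f(k) = f'(k) for all k ≥ 2, and 0 otherwise, and let H(h) := (1/|G|) ∑_{g ∈ G} U_g (h⊗1) U_g†. For a density matrix ρ on (Fin n → Fin d), let ρ_{01} be its two-site reduced state: ρ_{01}((x,y),(x',y')) = sum of ρ(f, f') over f, f' with f(0)=x, f(1)=y, f'(0)=x', f'(1)=y', and f(k)=f'(k) for all k ≥ 2; and let E_F(ρ_{01}) be its entanglement of formation. Then: sup { E_F(ρ_{01}) : ρ a density matrix on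 (Fin n → Fin d) with U_g ρ U_g† = ρ for all g ∈ G } = − inf { λ_min(H(h)) : h Hermitian on (Fin d) × (Fin d) such that Re trace(σ · h) + S(tr_A(σ)) ≥ 0 for every density matrix σ on (Fin d) × (Fin d) }, where λ_min denotes the smallest eigenvalue of a Hermitian matrix; moreover the supremum on the left-hand side is attained by some G-invariant density matrix. -/

import Mathlib

open Matrix
open scoped ComplexOrder

/-- A density matrix: positive semidefinite with trace one. -/
def IsDensityMatrix {I : Type*} [Fintype I] [DecidableEq I] (ρ : Matrix I I ℂ) : Prop :=
  ρ.PosSemidef ∧ ρ.trace = 1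

/-- The partial trace over the first tensor factor. -/
noncomputable def ptraceA {A B : Type*} [Fintype A] (σ : Matrix (A × B) (A × B) ℂ) :
    Matrix B B ℂ :=
  Matrix.of fun b b' => ∑ a, σ (a, b) (a, b')

/-- The von Neumann entropy `S(σ) = ∑ᵢ -λᵢ log λᵢ` of a (Hermitian) matrix. -/
noncomputable def vonNeumannEntropy {I : Type*} [Fintype I] [DecidableEq I]
    (σ : Matrix I I ℂ) : ℝ :=
  if h : σ.IsHermitian then ∑ i, Real.negMulLog (h.eigenvalues i) else 0

/-- The rank-one projector `|ψ⟩⟨ψ|`. -/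
def outer {I : Type*} (ψ : I → ℂ) : Matrix I I ℂ :=
  Matrix.of fun i j => ψ i * (starRingEnd ℂ) (ψ j)

/-- The entanglement of formation: the infimum of `∑ pᵢ S(tr_A |ψᵢ⟩⟨ψᵢ|)` over
pure-state decompositions of `ρ`. -/
noncomputable def entanglementOfFormation {A B : Type*} [Fintype A] [Fintype B]
    [DecidableEq A] [DecidableEq B] (ρ : Matrix (A × B) (A × B) ℂ) : ℝ :=
  sInf {x | ∃ (N : ℕ) (p : Fin N → ℝ) (ψ : Fin N → (A × B → ℂ)),
    (∀ i, 0 < p i) ∧ (∑ i, p i = 1) ∧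
    (∀ i, ∑ z, Complex.normSq (ψ i z) = 1) ∧
    (∑ i, (p i : ℂ) • outer (ψ i)) = ρ ∧
    x = ∑ i, p i * vonNeumannEntropy (ptraceA (outer (ψ i)))}

/-- The smallest eigenvalue of a (Hermitian) matrix. -/
noncomputable def lambdaMin {I : Type*} [Fintype I] [DecidableEq I]
    (M : Matrix I I ℂ) : ℝ :=
  if h : M.IsHermitian then ⨅ i, h.eigenvalues i else 0

/-- The unitary permuting the `n` tensor factors of `(ℂ^d)^{⊗n}` according to `g`. -/
def permMatrix (n d : ℕ) (g : Equiv.Perm (Fin n)) :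
    Matrix (Fin n → Fin d) (Fin n → Fin d) ℂ :=
  Matrix.of fun f f' => if f = f' ∘ ⇑g⁻¹ then 1 else 0

/-- The operator `h ⊗ 1`, acting as `h` on the first two sites and trivially on the rest. -/
def twoSiteObs (n d : ℕ) (hn : 2 ≤ n)
    (h : Matrix (Fin d × Fin d) (Fin d × Fin d) ℂ) :
    Matrix (Fin n → Fin d) (Fin n → Fin d) ℂ :=
  Matrix.of fun f f' =>
    if ∀ k : Fin n, 2 ≤ (k : ℕ) → f k = f' k then
      h (f ⟨0, by omega⟩, f ⟨1, by omega⟩) (f' ⟨0, by omega⟩, f' ⟨1, by omega⟩)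
    else 0

/-- The two-site reduced state on sites `0` and `1`. -/
noncomputable def twoSiteReduced (n d : ℕ) (hn : 2 ≤ n)
    (ρ : Matrix (Fin n → Fin d) (Fin n → Fin d) ℂ) :
    Matrix (Fin d × Fin d) (Fin d × Fin d) ℂ :=
  Matrix.of fun xy x'y' =>
    ∑ ff' ∈ Finset.univ.filter
        (fun ff' : (Fin n → Fin d) × (Fin n → Fin d) =>
          ff'.1 ⟨0, by omega⟩ = xy.1 ∧ ff'.1 ⟨1, by omega⟩ = xy.2 ∧
          ff'.2 ⟨0, by omega⟩ = x'y'.1 ∧ ff'.2 ⟨1, by omega⟩ = x'y'.2 ∧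
          ∀ k : Fin n, 2 ≤ (k : ℕ) → ff'.1 k = ff'.2 k),
      ρ ff'.1 ff'.2

/-- The group average `(1/|G|) ∑_{g ∈ G} U_g (h ⊗ 1) U_g†`. -/
noncomputable def avgHam (n d : ℕ) (hn : 2 ≤ n)
    (G : Subgroup (Equiv.Perm (Fin n))) [Fintype G]
    (h : Matrix (Fin d × Fin d) (Fin d × Fin d) ℂ) :
    Matrix (Fin n → Fin d) (Fin n → Fin d) ℂ :=
  ((Fintype.card G : ℂ))⁻¹ •
    ∑ g : G, permMatrix n d g * twoSiteObs n d hn h * (permMatrix n d g)ᴴ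

section Entropy

variable {I : Type*} [Fintype I] [DecidableEq I]

theorem outer_eq_vecMulVec {I : Type*} (ψ : I → ℂ) : outer ψ = vecMulVec ψ (star ψ) := rfl

theorem outer_posSemidef {I : Type*} [Fintype I] (ψ : I → ℂ) : (outer ψ).PosSemidef := by
  rw [outer_eq_vecMulVec]
  exact posSemidef_vecMulVec_self_star ψ

theorem trace_outer {I : Type*} [Fintype I] (ψ : I → ℂ) :
    (outer ψ).trace = ((∑ z, Complex.normSq (ψ z) : ℝ) : ℂ) := by
  simp [Matrix.trace, outer, Complex.mul_conj]

theorem outer_isDensityMatrix {ψ : I → ℂ} (h : ∑ z, Complex.normSq (ψ z) = 1) :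
    IsDensityMatrix (outer ψ) :=
  ⟨outer_posSemidef ψ, by rw [trace_outer, h, Complex.ofReal_one]⟩

theorem sum_normSq_col {U : Matrix I I ℂ} (hU : star U * U = 1) (j : I) :
    ∑ i, Complex.normSq (U i j) = 1 := by
  have h := congrFun (congrFun hU j) j
  simp only [Matrix.mul_apply, Matrix.star_apply, Matrix.one_apply_eq] at h
  have h2 : ((∑ i, Complex.normSq (U i j) : ℝ) : ℂ) = 1 := by
    rw [← h, Complex.ofReal_sum]
    refine Finset.sum_congr rfl fun i _ => ?_
    rw [Complex.normSq_eq_conj_mul_self]; rfl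
  exact_mod_cast h2

theorem sum_normSq_row {U : Matrix I I ℂ} (hU : U * star U = 1) (i : I) :
    ∑ j, Complex.normSq (U i j) = 1 := by
  have h := congrFun (congrFun hU i) i
  simp only [Matrix.mul_apply, Matrix.star_apply, Matrix.one_apply_eq] at h
  have h2 : ((∑ j, Complex.normSq (U i j) : ℝ) : ℂ) = 1 := by
    rw [← h, Complex.ofReal_sum]
    refine Finset.sum_congr rfl fun i _ => ?_
    rw [← Complex.mul_conj]; rfl
  exact_mod_cast h2

theorem mul_diagonal_mul_star (U : Matrix I I ℂ) (μ : I → ℝ) :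
    U * diagonal (fun i => (μ i : ℂ)) * star U
      = ∑ i, (μ i : ℂ) • outer (fun x => U x i) := by
  ext x y
  rw [Matrix.mul_apply, Matrix.sum_apply]
  simp only [mul_diagonal, Matrix.star_apply, Matrix.smul_apply, outer, of_apply, smul_eq_mul]
  refine Finset.sum_congr rfl fun i _ => ?_
  rw [← starRingEnd_apply]; ring

theorem Matrix.IsHermitian.eq_mul_diagonal_mul_star {A : Matrix I I ℂ} (hA : A.IsHermitian) :
    A = (hA.eigenvectorUnitary : Matrix I I ℂ) * diagonal (fun i => (hA.eigenvalues i : ℂ))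
      * star (hA.eigenvectorUnitary : Matrix I I ℂ) := by
  conv_lhs => rw [hA.spectral_theorem, Unitary.conjStarAlgAut_apply]
  rfl

theorem vonNeumannEntropy_eq {A : Matrix I I ℂ} (hA : A.IsHermitian) :
    vonNeumannEntropy A = ∑ i, Real.negMulLog (hA.eigenvalues i) := by
  simp [vonNeumannEntropy, hA]

theorem vonNeumannEntropy_eq_trace_cfc {A : Matrix I I ℂ} (hA : A.IsHermitian) :
    vonNeumannEntropy A = (cfc Real.negMulLog A).trace.re := by
  rw [vonNeumannEntropy_eq hA, hA.cfc_eq, Matrix.IsHermitian.cfc, Unitary.conjStarAlgAut_apply,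
    Matrix.trace_mul_cycle, Unitary.coe_star_mul_self, Matrix.one_mul, Matrix.trace_diagonal,
    Complex.re_sum]
  rfl

theorem IsDensityMatrix.sum_eigenvalues {A : Matrix I I ℂ} (hA : IsDensityMatrix A) :
    ∑ i, hA.1.1.eigenvalues i = 1 := by
  have h := hA.2.symm.trans hA.1.1.trace_eq_sum_eigenvalues
  have h2 : ((∑ i, hA.1.1.eigenvalues i : ℝ) : ℂ) = 1 := by
    rw [Complex.ofReal_sum]; exact h.symm
  exact_mod_cast h2

theorem IsDensityMatrix.eigenvalues_le_one {A : Matrix I I ℂ} (hA : IsDensityMatrix A) (i : I) :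
    hA.1.1.eigenvalues i ≤ 1 := by
  rw [← hA.sum_eigenvalues]
  exact Finset.single_le_sum (fun j _ => hA.1.eigenvalues_nonneg j) (Finset.mem_univ i)

theorem vonNeumannEntropy_nonneg {A : Matrix I I ℂ} (hA : IsDensityMatrix A) :
    0 ≤ vonNeumannEntropy A := by
  rw [vonNeumannEntropy_eq hA.1.1]
  exact Finset.sum_nonneg fun i _ =>
    Real.negMulLog_nonneg (hA.1.eigenvalues_nonneg i) (hA.eigenvalues_le_one i)

theorem vonNeumannEntropy_le_card {A : Matrix I I ℂ} (hA : IsDensityMatrix A) :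
    vonNeumannEntropy A ≤ Fintype.card I := by
  rw [vonNeumannEntropy_eq hA.1.1]
  calc ∑ i, Real.negMulLog (hA.1.1.eigenvalues i) ≤ ∑ _i : I, (1 : ℝ) := by
        refine Finset.sum_le_sum fun i _ => ?_
        have h0 := hA.1.eigenvalues_nonneg i
        have h1 := Real.negMulLog_le_one_sub_self h0
        linarith
    _ = Fintype.card I := by simp

open scoped Matrix.Norms.L2Operator in
theorem continuousOn_vonNeumannEntropy :
    ContinuousOn (vonNeumannEntropy (I := I)) {A | IsDensityMatrix A} := by
  have h := continuousOn_cfc (𝕜 := ℝ) (p := IsSelfAdjoint) (Matrix I I ℂ)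
    (isCompact_Icc (a := (0 : ℝ)) (b := 1)) Real.negMulLog
    Real.continuous_negMulLog.continuousOn
  have h2 : ContinuousOn (fun A : Matrix I I ℂ => (cfc Real.negMulLog A).trace.re)
      {A | IsDensityMatrix A} := by
    refine Complex.continuous_re.comp_continuousOn ?_
    refine (Continuous.matrix_trace continuous_id).comp_continuousOn (h.mono ?_)
    rintro A (hA : IsDensityMatrix A)
    refine ⟨hA.1.1, ?_⟩
    rw [hA.1.1.spectrum_real_eq_range_eigenvalues]
    rintro _ ⟨i, rfl⟩
    exact ⟨hA.1.eigenvalues_nonneg i, hA.eigenvalues_le_one i⟩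
  exact h2.congr fun A hA => vonNeumannEntropy_eq_trace_cfc hA.1.1

theorem IsDensityMatrix.convex_sum {ι : Type*} [Fintype ι] {p : ι → ℝ} {ρ : ι → Matrix I I ℂ}
    (hp : ∀ i, 0 ≤ p i) (hp1 : ∑ i, p i = 1) (hρ : ∀ i, IsDensityMatrix (ρ i)) :
    IsDensityMatrix (∑ i, (p i : ℂ) • ρ i) := by
  refine ⟨posSemidef_sum _ fun i _ => (hρ i).1.smul (by exact_mod_cast hp i), ?_⟩
  rw [trace_sum]
  simp only [trace_smul, (hρ _).2, smul_eq_mul, mul_one]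
  exact_mod_cast hp1

/-- Concavity of the von Neumann entropy. -/
theorem sum_mul_vonNeumannEntropy_le {ι : Type*} [Fintype ι] {p : ι → ℝ} {ρ : ι → Matrix I I ℂ}
    (hp : ∀ i, 0 ≤ p i) (hp1 : ∑ i, p i = 1) (hρ : ∀ i, IsDensityMatrix (ρ i)) :
    ∑ i, p i * vonNeumannEntropy (ρ i) ≤ vonNeumannEntropy (∑ i, (p i : ℂ) • ρ i) := by
  have hσ := IsDensityMatrix.convex_sum hp hp1 hρ
  set σ := ∑ i, (p i : ℂ) • ρ i with hσdef
  let U : Matrix I I ℂ := hσ.1.1.eigenvectorUnitary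
  let V : ι → Matrix I I ℂ := fun i => (hρ i).1.1.eigenvectorUnitary
  let μ : ι → I → ℝ := fun i => (hρ i).1.1.eigenvalues
  let W : ι → Matrix I I ℂ := fun i => star U * V i
  have hUU : U * star U = 1 := Unitary.coe_mul_star_self _
  have hUU' : star U * U = 1 := Unitary.coe_star_mul_self _
  have hVV : ∀ i, V i * star (V i) = 1 := fun i => Unitary.coe_mul_star_self _
  have hVV' : ∀ i, star (V i) * V i = 1 := fun i => Unitary.coe_star_mul_self _
  have hWW : ∀ i, W i * star (W i) = 1 := fun i => by
    simp only [W, star_mul, star_star]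
    rw [Matrix.mul_assoc, ← Matrix.mul_assoc (V i), hVV, Matrix.one_mul, hUU']
  have hWW' : ∀ i, star (W i) * W i = 1 := fun i => by
    simp only [W, star_mul, star_star]
    rw [Matrix.mul_assoc, ← Matrix.mul_assoc U, hUU, Matrix.one_mul, hVV']
  have hdiag : diagonal (fun k => (hσ.1.1.eigenvalues k : ℂ))
      = ∑ i, (p i : ℂ) • (W i * diagonal (fun j => (μ i j : ℂ)) * star (W i)) := by
    have h1 : star U * σ * U = diagonal (fun k => (hσ.1.1.eigenvalues k : ℂ)) := by
      conv_lhs => rw [hσ.1.1.eq_mul_diagonal_mul_star]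
      change star U * (U * _ * star U) * U = _
      rw [Matrix.mul_assoc, Matrix.mul_assoc, Matrix.mul_assoc, hUU', Matrix.mul_one,
        ← Matrix.mul_assoc, hUU', Matrix.one_mul]
    rw [← h1, hσdef, Matrix.mul_sum, Matrix.sum_mul]
    refine Finset.sum_congr rfl fun i _ => ?_
    rw [Matrix.mul_smul, Matrix.smul_mul]
    congr 1
    conv_lhs => rw [(hρ i).1.1.eq_mul_diagonal_mul_star]
    change star U * (V i * diagonal (fun j => (μ i j : ℂ)) * star (V i)) * U = _
    simp only [W, star_mul, star_star, Matrix.mul_assoc]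
  have hlam : ∀ k, hσ.1.1.eigenvalues k
      = ∑ q : ι × I, (p q.1 * Complex.normSq (W q.1 k q.2)) * μ q.1 q.2 := by
    intro k
    have h := congrFun (congrFun hdiag k) k
    simp only [mul_diagonal_mul_star, diagonal_apply_eq, Matrix.sum_apply, Matrix.smul_apply,
      outer, of_apply, smul_eq_mul, Complex.mul_conj] at h
    rw [Fintype.sum_prod_type]
    have h2 : (hσ.1.1.eigenvalues k : ℂ)
      = ((∑ i, ∑ j, (p i * Complex.normSq (W i k j)) * μ i j : ℝ) : ℂ) := by
      rw [h]
      push_cast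
      refine Finset.sum_congr rfl fun i _ => ?_
      rw [Finset.mul_sum]
      refine Finset.sum_congr rfl fun j _ => ?_
      ring
    exact_mod_cast h2
  have hJ : ∀ k, ∑ q : ι × I, (p q.1 * Complex.normSq (W q.1 k q.2)) * Real.negMulLog (μ q.1 q.2)
      ≤ Real.negMulLog (hσ.1.1.eigenvalues k) := by
    intro k
    rw [hlam k]
    have := Real.concaveOn_negMulLog.le_map_sum (t := Finset.univ)
      (w := fun q : ι × I => p q.1 * Complex.normSq (W q.1 k q.2))
      (p := fun q : ι × I => μ q.1 q.2)
      (fun q _ => mul_nonneg (hp _) (Complex.normSq_nonneg _)) ?_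
      (fun q _ => (hρ q.1).1.eigenvalues_nonneg q.2)
    · simpa only [smul_eq_mul] using this
    · rw [Fintype.sum_prod_type]
      simp only [← Finset.mul_sum, sum_normSq_row (hWW _), mul_one, hp1]
  rw [vonNeumannEntropy_eq hσ.1.1]
  refine le_trans (le_of_eq ?_) (Finset.sum_le_sum fun k _ => hJ k)
  rw [Finset.sum_comm, Fintype.sum_prod_type]
  refine Finset.sum_congr rfl fun i _ => ?_
  rw [vonNeumannEntropy_eq (hρ i).1.1, Finset.mul_sum]
  refine Finset.sum_congr rfl fun j _ => ?_
  rw [← Finset.sum_mul, ← Finset.mul_sum, sum_normSq_col (hWW' i), mul_one]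

end Entropy

section Roof

variable {A B : Type*} [Fintype A] [Fintype B] [DecidableEq A] [DecidableEq B]

theorem ptraceA_eq_sum {A B : Type*} [Fintype A] (σ : Matrix (A × B) (A × B) ℂ) :
    ptraceA σ = ∑ a, σ.submatrix (fun b => (a, b)) (fun b => (a, b)) := by
  ext b b'
  simp [ptraceA, Matrix.sum_apply]

theorem IsDensityMatrix.ptraceA {σ : Matrix (A × B) (A × B) ℂ} (h : IsDensityMatrix σ) :
    IsDensityMatrix (ptraceA σ) := by
  refine ⟨?_, ?_⟩
  · rw [ptraceA_eq_sum]
    exact posSemidef_sum _ fun a _ => h.1.submatrix _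
  · rw [← h.2, Matrix.trace, Matrix.trace, Fintype.sum_prod_type, Finset.sum_comm]
    rfl

theorem ptraceA_sum_smul {A B ι : Type*} [Fintype A] [Fintype ι] (p : ι → ℂ)
    (σ : ι → Matrix (A × B) (A × B) ℂ) :
    ptraceA (∑ i, p i • σ i) = ∑ i, p i • ptraceA (σ i) := by
  ext b b'
  simp only [ptraceA, of_apply, Matrix.sum_apply, Matrix.smul_apply, smul_eq_mul, Finset.mul_sum]
  rw [Finset.sum_comm]

theorem continuous_ptraceA {A B : Type*} [Fintype A] :
    Continuous (ptraceA : Matrix (A × B) (A × B) ℂ → Matrix B B ℂ) := by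
  refine continuous_matrix fun b b' => ?_
  exact continuous_finsetSum _ fun a _ => (continuous_id.matrix_elem _ _)

theorem continuous_outer {I : Type*} : Continuous (outer : (I → ℂ) → Matrix I I ℂ) := by
  refine continuous_matrix fun i j => ?_
  simp only [outer, of_apply]
  exact (continuous_apply i).mul (Complex.continuous_conj.comp (continuous_apply j))

/-- The squared Euclidean norm of a vector. -/
noncomputable def sqNorm {I : Type*} [Fintype I] (φ : I → ℂ) : ℝ := ∑ z, Complex.normSq (φ z)

theorem sqNorm_nonneg {I : Type*} [Fintype I] (φ : I → ℂ) : 0 ≤ sqNorm φ :=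
  Finset.sum_nonneg fun _ _ => Complex.normSq_nonneg _

theorem continuous_sqNorm {I : Type*} [Fintype I] : Continuous (sqNorm (I := I)) :=
  continuous_finsetSum _ fun i _ => Complex.continuous_normSq.comp (continuous_apply i)

theorem sqNorm_smul {I : Type*} [Fintype I] (c : ℂ) (φ : I → ℂ) :
    sqNorm (c • φ) = Complex.normSq c * sqNorm φ := by
  simp [sqNorm, Finset.mul_sum]

theorem sqNorm_eq_zero {I : Type*} [Fintype I] {φ : I → ℂ} : sqNorm φ = 0 ↔ φ = 0 := by
  rw [sqNorm, Finset.sum_eq_zero_iff_of_nonneg fun _ _ => Complex.normSq_nonneg _]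
  simp [funext_iff]

theorem outer_smul {I : Type*} (c : ℂ) (φ : I → ℂ) :
    outer (c • φ) = (Complex.normSq c : ℂ) • outer φ := by
  ext i j
  simp only [outer, of_apply, Pi.smul_apply, smul_eq_mul, map_mul, Matrix.smul_apply,
    ← Complex.mul_conj]
  ring

/-- The normalization of a vector. -/
noncomputable def normalized {I : Type*} [Fintype I] (φ : I → ℂ) : I → ℂ :=
  ((√(sqNorm φ))⁻¹ : ℂ) • φ

theorem sqNorm_normalized {I : Type*} [Fintype I] {φ : I → ℂ} (h : φ ≠ 0) :
    sqNorm (normalized φ) = 1 := by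
  have h0 : sqNorm φ ≠ 0 := sqNorm_eq_zero.not.mpr h
  rw [normalized, sqNorm_smul, map_inv₀, Complex.normSq_ofReal,
    Real.mul_self_sqrt (sqNorm_nonneg φ), inv_mul_cancel₀ h0]

theorem sqNorm_smul_outer_normalized {I : Type*} [Fintype I] (φ : I → ℂ) :
    (sqNorm φ : ℂ) • outer (normalized φ) = outer φ := by
  by_cases h : φ = 0
  · subst h
    ext i j
    simp [outer, sqNorm]
  have h0 : sqNorm φ ≠ 0 := sqNorm_eq_zero.not.mpr h
  rw [normalized, outer_smul, smul_smul, map_inv₀, Complex.normSq_ofReal,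
    Real.mul_self_sqrt (sqNorm_nonneg φ), ← Complex.ofReal_mul, mul_inv_cancel₀ h0,
    Complex.ofReal_one, one_smul]

/-- The entanglement of a pure state, extended homogeneously to subnormalized vectors. -/
noncomputable def pureEntanglement (φ : A × B → ℂ) : ℝ :=
  sqNorm φ * vonNeumannEntropy (ptraceA (outer (normalized φ)))

theorem pureEntanglement_smul {A B : Type*} [Fintype A] [Fintype B] [DecidableEq B] {p : ℝ}
    (hp : 0 < p) {ψ : A × B → ℂ} (hψ : sqNorm ψ = 1) :
    pureEntanglement ((√p : ℂ) • ψ) = p * vonNeumannEntropy (ptraceA (outer ψ)) := by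
  have h1 : sqNorm ((√p : ℂ) • ψ) = p := by
    rw [sqNorm_smul, hψ, mul_one, Complex.normSq_ofReal, Real.mul_self_sqrt hp.le]
  have h2 : normalized ((√p : ℂ) • ψ) = ψ := by
    rw [normalized, h1, smul_smul, inv_mul_cancel₀, one_smul]
    exact_mod_cast (Real.sqrt_pos.mpr hp).ne'
  rw [pureEntanglement, h1, h2]

theorem continuous_pureEntanglement : Continuous (pureEntanglement (A := A) (B := B)) := by
  rw [continuous_iff_continuousAt]
  intro φ
  by_cases hφ : φ = 0
  · subst hφ
    have h0 : sqNorm (0 : A × B → ℂ) = 0 := sqNorm_eq_zero.mpr rfl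
    have hlim : Filter.Tendsto (fun φ : A × B → ℂ => sqNorm φ * Fintype.card B) (nhds 0)
        (nhds 0) := by
      have := (continuous_sqNorm (I := A × B)).tendsto 0
      rw [h0] at this
      simpa using this.mul_const (Fintype.card B : ℝ)
    have hz : pureEntanglement (0 : A × B → ℂ) = 0 := by simp [pureEntanglement, h0]
    rw [ContinuousAt, hz]
    refine squeeze_zero (fun φ => ?_) (fun φ => ?_) hlim
    all_goals
      by_cases h : φ = 0
      · subst h; simp [hz, h0]
      have hd := (outer_isDensityMatrix (sqNorm_normalized h)).ptraceA
    · exact mul_nonneg (sqNorm_nonneg _) (vonNeumannEntropy_nonneg hd)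
    · exact mul_le_mul_of_nonneg_left (vonNeumannEntropy_le_card hd) (sqNorm_nonneg _)
  · have hopen : IsOpen {φ : A × B → ℂ | φ ≠ 0} := isOpen_ne
    refine ContinuousOn.continuousAt (s := {φ | φ ≠ 0}) ?_ (hopen.mem_nhds hφ)
    refine continuous_sqNorm.continuousOn.mul ?_
    refine continuousOn_vonNeumannEntropy.comp (t := {σ | IsDensityMatrix σ}) ?_
      fun ψ hψ => (outer_isDensityMatrix (sqNorm_normalized hψ)).ptraceA
    refine (continuous_ptraceA.comp continuous_outer).comp_continuousOn ?_
    have hinv : ContinuousOn (fun ψ : A × B → ℂ => ((√(sqNorm ψ) : ℝ) : ℂ)⁻¹) {φ | φ ≠ 0} := by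
      refine ContinuousOn.inv₀ (Complex.continuous_ofReal.comp
        (Real.continuous_sqrt.comp continuous_sqNorm)).continuousOn fun ψ hψ => ?_
      have : 0 < sqNorm ψ := lt_of_le_of_ne (sqNorm_nonneg _) (Ne.symm (sqNorm_eq_zero.not.mpr hψ))
      exact_mod_cast (Real.sqrt_pos.mpr this).ne'
    exact hinv.smul continuousOn_id

/-- The set of average entanglements of pure-state decompositions of `ρ`. -/
def decompositionValues (ρ : Matrix (A × B) (A × B) ℂ) : Set ℝ :=
  {x | ∃ (N : ℕ) (p : Fin N → ℝ) (ψ : Fin N → (A × B → ℂ)),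
    (∀ i, 0 < p i) ∧ (∑ i, p i = 1) ∧
    (∀ i, ∑ z, Complex.normSq (ψ i z) = 1) ∧
    (∑ i, (p i : ℂ) • outer (ψ i)) = ρ ∧
    x = ∑ i, p i * vonNeumannEntropy (ptraceA (outer (ψ i)))}

theorem decompositionValues_nonneg {ρ : Matrix (A × B) (A × B) ℂ} {x : ℝ}
    (hx : x ∈ decompositionValues ρ) : 0 ≤ x := by
  obtain ⟨N, p, ψ, hp, -, hψ, -, rfl⟩ := hx
  exact Finset.sum_nonneg fun i _ => mul_nonneg (hp i).le
    (vonNeumannEntropy_nonneg (outer_isDensityMatrix (hψ i)).ptraceA)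

theorem bddBelow_decompositionValues (ρ : Matrix (A × B) (A × B) ℂ) :
    BddBelow (decompositionValues ρ) := ⟨0, fun _ hx => decompositionValues_nonneg hx⟩

theorem sum_subtype_equiv {ι κ M : Type*} [Fintype ι] [Fintype κ] [AddCommMonoid M]
    {P : ι → Prop} [DecidablePred P] (e : κ ≃ {i // P i}) (f : ι → M)
    (hf : ∀ i, ¬ P i → f i = 0) : ∑ j, f (e j) = ∑ i, f i := by
  rw [Equiv.sum_comp e (fun i => f i),
    ← Finset.sum_subtype (Finset.univ.filter fun i => P i) (by simp) f]
  exact Finset.sum_filter_of_ne fun i _ h => not_not.mp fun hi => h (hf i hi)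

theorem sum_pureEntanglement_mem {A B ι : Type*} [Fintype A] [Fintype B] [DecidableEq B]
    [Fintype ι] {φ : ι → A × B → ℂ} {ρ : Matrix (A × B) (A × B) ℂ}
    (hρ : ∑ i, outer (φ i) = ρ) (htr : ρ.trace = 1) :
    ∑ i, pureEntanglement (φ i) ∈ decompositionValues ρ := by
  classical
  let e := (Fintype.equivFin {i : ι // φ i ≠ 0}).symm
  refine ⟨_, fun j => sqNorm (φ (e j)), fun j => normalized (φ (e j)), fun j => ?_, ?_,
    fun j => sqNorm_normalized (e j).2, ?_, ?_⟩
  · exact lt_of_le_of_ne (sqNorm_nonneg _) (Ne.symm (sqNorm_eq_zero.not.mpr (e j).2))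
  · rw [sum_subtype_equiv e (fun i => sqNorm (φ i)) fun i hi => sqNorm_eq_zero.mpr (not_not.mp hi)]
    have : ((∑ i, sqNorm (φ i) : ℝ) : ℂ) = 1 := by
      rw [← htr, ← hρ, trace_sum, Complex.ofReal_sum]
      exact Finset.sum_congr rfl fun i _ => (trace_outer _).symm
    exact_mod_cast this
  · simp only [sqNorm_smul_outer_normalized]
    rw [← hρ]
    refine sum_subtype_equiv e (fun i => outer (φ i)) fun i hi => ?_
    rw [not_not.mp hi]; ext; simp [outer]
  · refine (sum_subtype_equiv e (fun i => pureEntanglement (φ i)) fun i hi => ?_).symm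
    rw [pureEntanglement, sqNorm_eq_zero.mpr (not_not.mp hi), zero_mul]

theorem entanglementOfFormation_le_sum {ι : Type*} [Fintype ι] {φ : ι → A × B → ℂ}
    {ρ : Matrix (A × B) (A × B) ℂ} (hρ : ∑ i, outer (φ i) = ρ) (htr : ρ.trace = 1) :
    entanglementOfFormation ρ ≤ ∑ i, pureEntanglement (φ i) :=
  csInf_le (bddBelow_decompositionValues ρ) (sum_pureEntanglement_mem hρ htr)

theorem sum_outer_col {I J : Type*} [Fintype J] (M : Matrix I J ℂ) :
    ∑ j, outer (fun i => M i j) = M * Mᴴ := by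
  ext x y
  simp [Matrix.sum_apply, Matrix.mul_apply, outer]

theorem Matrix.PosSemidef.exists_isHermitian_mul_self {I : Type*} [Fintype I] [DecidableEq I]
    {M : Matrix I I ℂ} (hM : M.PosSemidef) :
    ∃ C : Matrix I I ℂ, C.IsHermitian ∧ C * C = M := by
  let U : Matrix I I ℂ := hM.1.eigenvectorUnitary
  have hU : star U * U = 1 := Unitary.coe_star_mul_self _
  let D : Matrix I I ℂ := diagonal (fun i => ((√(hM.1.eigenvalues i) : ℝ) : ℂ))
  refine ⟨U * D * star U, ?_, ?_⟩
  · refine isHermitian_mul_mul_conjTranspose U ?_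
    rw [isHermitian_diagonal_iff]
    intro i
    exact Complex.conj_ofReal _
  · calc U * D * star U * (U * D * star U) = U * D * (star U * U) * D * star U := by
          simp only [Matrix.mul_assoc]
      _ = M := by
          rw [hU, Matrix.mul_one, Matrix.mul_assoc U, diagonal_mul_diagonal]
          conv_rhs => rw [hM.1.eq_mul_diagonal_mul_star]
          congr 3
          funext i
          rw [← Complex.ofReal_mul, Real.mul_self_sqrt (hM.eigenvalues_nonneg i)]

theorem decompositionValues_nonempty {ρ : Matrix (A × B) (A × B) ℂ} (hρ : IsDensityMatrix ρ) :
    (decompositionValues ρ).Nonempty := by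
  obtain ⟨C, hC, hCρ⟩ := hρ.1.exists_isHermitian_mul_self
  exact ⟨_, sum_pureEntanglement_mem (φ := fun j i => C i j)
    (by rw [sum_outer_col, hC.eq, hCρ]) hρ.2⟩

end Roof

section ConvexHull

instance Matrix.instLocallyConvexSpaceReal {I J : Type*} : LocallyConvexSpace ℝ (Matrix I J ℂ) :=
  inferInstanceAs (LocallyConvexSpace ℝ (I → J → ℂ))

/-- In finite dimension, the convex hull of a compact set is compact. -/
theorem IsCompact.isCompact_convexHull_of_finiteDimensional {E : Type*} [AddCommGroup E]
    [Module ℝ E] [TopologicalSpace E] [ContinuousAdd E] [ContinuousSMul ℝ E]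
    [FiniteDimensional ℝ E] {s : Set E} (hs : IsCompact s) : IsCompact (convexHull ℝ s) := by
  have heq : convexHull ℝ s = ⋃ k ∈ Set.Iic (Module.finrank ℝ E + 1),
      (fun q : (Fin k → ℝ) × (Fin k → E) => ∑ i, q.1 i • q.2 i) ''
        (stdSimplex ℝ (Fin k) ×ˢ Set.univ.pi fun _ => s) := by
    ext x
    simp only [Set.mem_iUnion, Set.mem_image, Set.mem_prod, Set.mem_univ_pi, Set.mem_Iic,
      Prod.exists, exists_prop]
    constructor
    · intro hx
      obtain ⟨ι, _, z, w, hz, hind, hw, hw1, hsum⟩ := eq_pos_convex_span_of_mem_convexHull hx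
      let e := (Fintype.equivFin ι).symm
      refine ⟨Fintype.card ι, ?_, fun i => w (e i), fun i => z (e i), ⟨⟨fun i => (hw _).le, ?_⟩,
        fun i => hz ⟨_, rfl⟩⟩, ?_⟩
      · exact hind.card_le_finrank_succ.trans (by gcongr; exact Submodule.finrank_le _)
      · rw [← hw1]; exact Equiv.sum_comp e w
      · rw [← hsum]; exact Equiv.sum_comp e fun i => w i • z i
    · rintro ⟨k, -, w, z, ⟨⟨hw0, hw1⟩, hz⟩, rfl⟩
      exact mem_convexHull_of_exists_fintype w z hw0 hw1 hz rfl
  rw [heq]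
  refine (Set.finite_Iic _).isCompact_biUnion fun k _ => ?_
  refine ((isCompact_stdSimplex ℝ (Fin k)).prod (isCompact_univ_pi fun _ => hs)).image ?_
  exact continuous_finsetSum _ fun i _ =>
    ((continuous_apply i).comp continuous_fst).smul ((continuous_apply i).comp continuous_snd)

end ConvexHull

section Duality

variable {I : Type*} [Fintype I]

/-- Every real-linear functional is represented on Hermitian matrices by a Hermitian matrix. -/
theorem exists_isHermitian_forall_eq_trace [DecidableEq I] (f : Matrix I I ℂ →ₗ[ℝ] ℝ) :
    ∃ h : Matrix I I ℂ, h.IsHermitian ∧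
      ∀ σ : Matrix I I ℂ, σ.IsHermitian → f σ = ((σ * h).trace).re := by
  let k : Matrix I I ℂ := Matrix.of fun j i =>
    (f (Matrix.single i j (1 : ℂ)) : ℂ) - (f (Matrix.single i j Complex.I) : ℂ) * Complex.I
  have hk : ∀ σ : Matrix I I ℂ, f σ = ((σ * k).trace).re := by
    intro σ
    have h1 : σ = ∑ i, ∑ j, ((σ i j).re • (Matrix.single i j (1 : ℂ))
        + (σ i j).im • (Matrix.single i j Complex.I)) := by
      conv_lhs => rw [matrix_eq_sum_single σ]
      refine Finset.sum_congr rfl fun i _ => Finset.sum_congr rfl fun j _ => ?_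
      rw [Matrix.smul_single, Matrix.smul_single, ← Matrix.single_add]
      congr 1
      apply Complex.ext <;> simp
    conv_lhs => rw [h1]
    simp only [map_sum, map_add, map_smul, smul_eq_mul, Matrix.trace, Matrix.diag_apply,
      Matrix.mul_apply, Complex.re_sum]
    refine Finset.sum_congr rfl fun i _ => Finset.sum_congr rfl fun j _ => ?_
    simp [k]
  refine ⟨(2⁻¹ : ℂ) • (k + kᴴ), ?_, fun σ hσ => ?_⟩
  · rw [IsHermitian, conjTranspose_smul, conjTranspose_add, conjTranspose_conjTranspose, add_comm]
    simp
  · have h2 : ((σ * kᴴ).trace).re = ((σ * k).trace).re := by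
      have : (σ * kᴴ).trace = star ((σ * k).trace) := by
        rw [← Matrix.trace_conjTranspose, conjTranspose_mul, hσ.eq, Matrix.trace_mul_comm]
      rw [this]; rfl
    rw [hk σ, Matrix.mul_smul, Matrix.mul_add, Matrix.trace_smul, Matrix.trace_add, smul_eq_mul,
      show (2⁻¹ : ℂ) = ((2⁻¹ : ℝ) : ℂ) by push_cast; rfl, Complex.re_ofReal_mul, Complex.add_re, h2]
    ring

theorem isCompact_sqNorm_eq_one : IsCompact {ψ : I → ℂ | sqNorm ψ = 1} := by
  refine Metric.isCompact_of_isClosed_isBounded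
    (isClosed_eq continuous_sqNorm continuous_const) ?_
  refine (Metric.isBounded_closedBall (x := (0 : I → ℂ)) (r := 1)).subset fun ψ hψ => ?_
  rw [mem_closedBall_zero_iff, pi_norm_le_iff_of_nonneg zero_le_one]
  intro z
  have h1 : Complex.normSq (ψ z) ≤ 1 := by
    rw [← show sqNorm ψ = 1 from hψ]
    exact Finset.single_le_sum (f := fun z => Complex.normSq (ψ z))
      (fun _ _ => Complex.normSq_nonneg _) (Finset.mem_univ z)
  rw [Complex.normSq_eq_norm_sq] at h1
  exact (sq_le_one_iff₀ (norm_nonneg _)).mp h1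

variable {A B : Type*} [Fintype A] [Fintype B] [DecidableEq A] [DecidableEq B]

theorem pureEntanglement_of_sqNorm_eq_one {A B : Type*} [Fintype A] [Fintype B] [DecidableEq B]
    {ψ : A × B → ℂ} (hψ : sqNorm ψ = 1) :
    pureEntanglement ψ = vonNeumannEntropy (ptraceA (outer ψ)) := by
  simpa using pureEntanglement_smul one_pos hψ

theorem pureEntanglement_sqrt_smul {A B : Type*} [Fintype A] [Fintype B] [DecidableEq B]
    {w : ℝ} (hw : 0 ≤ w) {ψ : A × B → ℂ} (hψ : sqNorm ψ = 1) :
    pureEntanglement ((√w : ℂ) • ψ) = w * pureEntanglement ψ := by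
  rcases hw.eq_or_lt with rfl | hw
  · simp [pureEntanglement, sqNorm_eq_zero.mpr]
  · rw [pureEntanglement_smul hw hψ, pureEntanglement_of_sqNorm_eq_one hψ]

theorem outer_sqrt_smul {I : Type*} {w : ℝ} (hw : 0 ≤ w) (ψ : I → ℂ) :
    outer ((√w : ℂ) • ψ) = (w : ℂ) • outer ψ := by
  rw [outer_smul, Complex.normSq_ofReal, Real.mul_self_sqrt hw]

theorem trace_sum_smul_mul_re {ι : Type*} [Fintype ι] (p : ι → ℝ) (σ : ι → Matrix I I ℂ)
    (h : Matrix I I ℂ) :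
    (((∑ i, (p i : ℂ) • σ i) * h).trace).re = ∑ i, p i * ((σ i * h).trace).re := by
  rw [Matrix.sum_mul, Matrix.trace_sum, Complex.re_sum]
  refine Finset.sum_congr rfl fun i _ => ?_
  rw [Matrix.smul_mul, Matrix.trace_smul, smul_eq_mul, Complex.re_ofReal_mul]

theorem neg_trace_le_entanglementOfFormation {h σ : Matrix (A × B) (A × B) ℂ}
    (hfeas : ∀ τ : Matrix (A × B) (A × B) ℂ, IsDensityMatrix τ →
      0 ≤ ((τ * h).trace).re + vonNeumannEntropy (ptraceA τ)) (hσ : IsDensityMatrix σ) :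
    -((σ * h).trace).re ≤ entanglementOfFormation σ := by
  refine le_csInf (decompositionValues_nonempty hσ) ?_
  rintro _ ⟨N, p, ψ, hp, -, hψ, rfl, rfl⟩
  rw [trace_sum_smul_mul_re, neg_le_iff_add_nonneg', ← Finset.sum_add_distrib]
  refine Finset.sum_nonneg fun i _ => ?_
  rw [← mul_add]
  exact mul_nonneg (hp i).le (hfeas _ (outer_isDensityMatrix (hψ i)))

/-- By concavity of the entropy, an inequality for pure states extends to all states. -/
theorem trace_add_entropy_nonneg_of_pure {h : Matrix (A × B) (A × B) ℂ}
    (hpure : ∀ ψ : A × B → ℂ, sqNorm ψ = 1 →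
      0 ≤ ((outer ψ * h).trace).re + vonNeumannEntropy (ptraceA (outer ψ)))
    {σ : Matrix (A × B) (A × B) ℂ} (hσ : IsDensityMatrix σ) :
    0 ≤ ((σ * h).trace).re + vonNeumannEntropy (ptraceA σ) := by
  let U : Matrix (A × B) (A × B) ℂ := hσ.1.1.eigenvectorUnitary
  let e : A × B → A × B → ℂ := fun i x => U x i
  let μ := hσ.1.1.eigenvalues
  have he : ∀ i, sqNorm (e i) = 1 := fun i => sum_normSq_col (Unitary.coe_star_mul_self _) i
  have hμ : ∀ i, 0 ≤ μ i := hσ.1.eigenvalues_nonneg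
  have hμ1 : ∑ i, μ i = 1 := hσ.sum_eigenvalues
  have hdec : σ = ∑ i, (μ i : ℂ) • outer (e i) := by
    conv_lhs => rw [hσ.1.1.eq_mul_diagonal_mul_star, mul_diagonal_mul_star]
  rw [hdec, ptraceA_sum_smul, trace_sum_smul_mul_re]
  refine le_trans ?_ (add_le_add le_rfl (sum_mul_vonNeumannEntropy_le hμ hμ1
    fun i => (outer_isDensityMatrix (he i)).ptraceA))
  rw [← Finset.sum_add_distrib]
  refine Finset.sum_nonneg fun i _ => ?_
  rw [← mul_add]
  exact mul_nonneg (hμ i) (hpure _ (he i))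

/-- The pairs `(|ψ⟩⟨ψ|, S(tr_A |ψ⟩⟨ψ|))` for unit vectors `ψ`. -/
def pureGraph (A B : Type*) [Fintype A] [Fintype B] [DecidableEq B] :
    Set (Matrix (A × B) (A × B) ℂ × ℝ) :=
  (fun ψ => (outer ψ, pureEntanglement ψ)) '' {ψ | sqNorm ψ = 1}

theorem isCompact_convexHull_pureGraph : IsCompact (convexHull ℝ (pureGraph A B)) := by
  have hc : Continuous fun ψ : A × B → ℂ => (outer ψ, pureEntanglement ψ) :=
    Continuous.prodMk continuous_outer continuous_pureEntanglement
  exact (isCompact_sqNorm_eq_one.image hc).isCompact_convexHull_of_finiteDimensional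

theorem entanglementOfFormation_le_of_mem_convexHull {σ : Matrix (A × B) (A × B) ℂ} {t : ℝ}
    (hσ : σ.trace = 1) (h : (σ, t) ∈ convexHull ℝ (pureGraph A B)) :
    entanglementOfFormation σ ≤ t := by
  obtain ⟨ι, _, w, z, hw, -, hz, hsum⟩ := mem_convexHull_iff_exists_fintype.mp h
  choose ψ hψ hψz using hz
  have h1 : ∑ i, outer ((√(w i) : ℂ) • ψ i) = σ := by
    have := congrArg Prod.fst hsum
    rw [Prod.fst_sum] at this
    refine Eq.trans ?_ this
    refine Finset.sum_congr rfl fun i _ => ?_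
    rw [outer_sqrt_smul (hw i), ← hψz i]
    ext x y
    simp
  have h2 : ∑ i, pureEntanglement ((√(w i) : ℂ) • ψ i) = t := by
    have := congrArg Prod.snd hsum
    rw [Prod.snd_sum] at this
    refine Eq.trans ?_ this
    refine Finset.sum_congr rfl fun i _ => ?_
    rw [pureEntanglement_sqrt_smul (hw i) (hψ i), ← hψz i]
    simp
  rw [← h2]
  exact entanglementOfFormation_le_sum h1 hσ

theorem mem_convexHull_of_mem_decompositionValues {A B : Type*} [Fintype A] [Fintype B]
    [DecidableEq B] {σ : Matrix (A × B) (A × B) ℂ} {t : ℝ}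
    (h : t ∈ decompositionValues σ) :
    (σ, t) ∈ convexHull ℝ (pureGraph A B) := by
  obtain ⟨N, p, ψ, hp, hp1, hψ, rfl, rfl⟩ := h
  refine mem_convexHull_of_exists_fintype p
    (fun i => (outer (ψ i), pureEntanglement (ψ i)))
    (fun i => (hp i).le) hp1 (fun i => ⟨ψ i, hψ i, rfl⟩) ?_
  refine Prod.ext ?_ ?_
  · rw [Prod.fst_sum]
    refine Finset.sum_congr rfl fun i _ => ?_
    ext x y
    simp
  · rw [Prod.snd_sum]
    refine Finset.sum_congr rfl fun i _ => ?_
    simp [pureEntanglement_of_sqNorm_eq_one (hψ i)]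

/-- Dual description of the entanglement of formation. -/
theorem exists_dual_witness {σ : Matrix (A × B) (A × B) ℂ} (hσ : IsDensityMatrix σ)
    {y : ℝ} (hy : y < entanglementOfFormation σ) :
    ∃ h : Matrix (A × B) (A × B) ℂ, h.IsHermitian ∧
      (∀ τ : Matrix (A × B) (A × B) ℂ, IsDensityMatrix τ →
        0 ≤ ((τ * h).trace).re + vonNeumannEntropy (ptraceA τ)) ∧
      y < -((σ * h).trace).re := by
  have hnot : (σ, y) ∉ convexHull ℝ (pureGraph A B) := fun hmem =>
    (entanglementOfFormation_le_of_mem_convexHull hσ.2 hmem).not_gt hy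
  obtain ⟨f, u, hfu, hf⟩ := geometric_hahn_banach_point_closed (convex_convexHull ℝ _)
    isCompact_convexHull_pureGraph.isClosed hnot
  let a : ℝ := f (0, 1)
  let g : Matrix (A × B) (A × B) ℂ →ₗ[ℝ] ℝ := f.toLinearMap ∘ₗ LinearMap.inl ℝ _ _
  have hsplit : ∀ (τ : Matrix (A × B) (A × B) ℂ) (t : ℝ), f (τ, t) = g τ + t * a := by
    intro τ t
    have : (τ, t) = (τ, (0 : ℝ)) + t • ((0 : Matrix (A × B) (A × B) ℂ), (1 : ℝ)) := by simp
    rw [this, map_add, map_smul]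
    rfl
  have ha : 0 < a := by
    obtain ⟨t, ht⟩ := decompositionValues_nonempty hσ
    have h1 := hf _ (mem_convexHull_of_mem_decompositionValues ht)
    have h2 : entanglementOfFormation σ ≤ t := csInf_le (bddBelow_decompositionValues σ) ht
    rw [hsplit] at h1 hfu
    have h3 : 0 < (t - y) * a := by linarith
    exact (pos_iff_pos_of_mul_pos h3).mp (by linarith)
  obtain ⟨k, hk, hkf⟩ := exists_isHermitian_forall_eq_trace g
  have htr : ∀ τ : Matrix (A × B) (A × B) ℂ, IsDensityMatrix τ →
      ((τ * ((a⁻¹ : ℝ) • (k - (u : ℂ) • 1))).trace).re = a⁻¹ * (g τ - u) := by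
    intro τ hτ
    rw [hkf τ hτ.1.1, Matrix.mul_smul, Matrix.trace_smul, Matrix.mul_sub, Matrix.trace_sub,
      Matrix.mul_smul, Matrix.mul_one, Matrix.trace_smul, hτ.2]
    simp
  refine ⟨(a⁻¹ : ℝ) • (k - (u : ℂ) • 1), ?_, fun τ hτ => ?_, ?_⟩
  · refine IsHermitian.smul (hk.sub ?_) (IsSelfAdjoint.all _)
    exact isHermitian_one.smul (Complex.conj_ofReal u)
  · refine trace_add_entropy_nonneg_of_pure (fun ψ hψ => ?_) hτ
    rw [htr _ (outer_isDensityMatrix hψ), ← pureEntanglement_of_sqNorm_eq_one hψ]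
    have h1 := hf _ (subset_convexHull ℝ _ ⟨ψ, hψ, rfl⟩)
    rw [hsplit] at h1
    have h2 : a⁻¹ * (g (outer ψ) - u) + pureEntanglement ψ
        = a⁻¹ * (g (outer ψ) + pureEntanglement ψ * a - u) := by
      field_simp
      ring
    rw [h2]
    exact mul_nonneg (inv_nonneg.mpr ha.le) (by linarith)
  · rw [htr σ hσ]
    rw [hsplit] at hfu
    have h2 : -(a⁻¹ * (g σ - u)) - y = a⁻¹ * (u - (g σ + y * a)) := by
      field_simp
      ring
    have h3 := mul_pos (inv_pos.mpr ha) (sub_pos.mpr hfu)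
    linarith

end Duality

section Attainment

theorem Matrix.IsHermitian.exists_pseudoInverse {I : Type*} [Fintype I] [DecidableEq I]
    {C : Matrix I I ℂ} (hC : C.IsHermitian) :
    ∃ P : Matrix I I ℂ, P.IsHermitian ∧ C * P * C = C ∧ P * C = C * P := by
  obtain ⟨U, μ, hU, rfl⟩ : ∃ (U : Matrix I I ℂ) (μ : I → ℝ), star U * U = 1 ∧
      C = U * diagonal (fun i => (μ i : ℂ)) * star U :=
    ⟨hC.eigenvectorUnitary, hC.eigenvalues, Unitary.coe_star_mul_self _,
      hC.eq_mul_diagonal_mul_star⟩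
  have hmul : ∀ μ ν : I → ℝ, U * diagonal (fun i => (μ i : ℂ)) * star U *
      (U * diagonal (fun i => (ν i : ℂ)) * star U) =
      U * diagonal (fun i => ((μ i * ν i : ℝ) : ℂ)) * star U := fun μ ν => by
    calc _ = U * diagonal (fun i => (μ i : ℂ)) * (star U * U)
          * diagonal (fun i => (ν i : ℂ)) * star U := by simp only [Matrix.mul_assoc]
      _ = _ := by
          rw [hU, Matrix.mul_one, Matrix.mul_assoc U, diagonal_mul_diagonal]
          simp only [Complex.ofReal_mul]
  refine ⟨U * diagonal (fun i => (((μ i)⁻¹ : ℝ) : ℂ)) * star U,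
    isHermitian_mul_mul_conjTranspose U ?_, ?_, ?_⟩
  · rw [isHermitian_diagonal_iff]
    exact fun i => Complex.conj_ofReal _
  · simp only [hmul, mul_inv_mul_cancel]
  · simp only [hmul, mul_comm]

variable {A B : Type*} [Fintype A] [Fintype B] [DecidableEq A] [DecidableEq B]

/-- The entanglement of formation is upper semicontinuous in the Hermitian square root. -/
theorem upperSemicontinuousOn_entanglementOfFormation_mul_self :
    UpperSemicontinuousOn
      (fun C : Matrix (A × B) (A × B) ℂ => entanglementOfFormation (C * C))
      {C | C.IsHermitian ∧ (C * C).trace = 1} := by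
  rintro C₀ ⟨hC₀, htr₀⟩ y hy
  have hdens : IsDensityMatrix (C₀ * C₀) := by
    refine ⟨?_, htr₀⟩
    conv => rw [← congrArg (C₀ * ·) hC₀.eq]
    exact posSemidef_self_mul_conjTranspose C₀
  obtain ⟨x, ⟨N, p, ψ, hp, hp1, hψ, hdec, rfl⟩, hxy⟩ :=
    exists_lt_of_csInf_lt (decompositionValues_nonempty hdens) hy
  obtain ⟨P, hP, hCPC, hPC⟩ := hC₀.exists_pseudoInverse
  let Φ : Matrix (A × B) (Fin N) ℂ := Matrix.of fun z i => ((√(p i) : ℂ) • ψ i) z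
  have hΦ : Φ * Φᴴ = C₀ * C₀ := by
    rw [← sum_outer_col, ← hdec]
    exact Finset.sum_congr rfl fun i _ => outer_sqrt_smul (hp i).le (ψ i)
  let Q := C₀ * P
  have hQ : Qᴴ = Q := by
    simp only [Q]
    rw [conjTranspose_mul, hP.eq, hC₀.eq, hPC]
  let W := 1 - Q
  have hW : Wᴴ = W := by simp only [W, conjTranspose_sub, conjTranspose_one, hQ]
  have hQC : Q * C₀ = C₀ := hCPC
  have hCQ : C₀ * Q = C₀ := by
    simp only [Q]
    rw [← hPC, ← Matrix.mul_assoc, hCPC]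
  have hQQ : Q * Q = Q := by
    simp only [Q]
    rw [← Matrix.mul_assoc, hCPC]
  have hWC : W * C₀ = 0 := by simp only [W, Matrix.sub_mul, Matrix.one_mul, hQC, sub_self]
  have hCW : C₀ * W = 0 := by simp only [W, Matrix.mul_sub, Matrix.mul_one, hCQ, sub_self]
  have hWW : W * Wᴴ = W := by
    rw [hW]
    simp only [W, Matrix.mul_sub, Matrix.sub_mul, Matrix.mul_one, Matrix.one_mul, hQQ]
    abel
  have hWΦ : W * Φ = 0 := by
    rw [← self_mul_conjTranspose_eq_zero, conjTranspose_mul, ← Matrix.mul_assoc,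
      Matrix.mul_assoc W, hΦ, ← Matrix.mul_assoc, hWC, Matrix.zero_mul, Matrix.zero_mul]
  let V := P * Φ
  have hV : V * Vᴴ = Q := by
    simp only [V]
    rw [conjTranspose_mul, hP.eq, Matrix.mul_assoc, ← Matrix.mul_assoc Φ, hΦ,
      Matrix.mul_assoc C₀, ← Matrix.mul_assoc P, hPC]
    exact hQQ
  have hCV : C₀ * V = Φ := by
    have h : Φ = Q * Φ + W * Φ := by rw [← Matrix.add_mul]; simp [W]
    rw [hWΦ, add_zero] at h
    simp only [V]
    rw [← Matrix.mul_assoc]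
    exact h.symm
  let F : Matrix (A × B) (A × B) ℂ → ℝ := fun C =>
    ∑ j, pureEntanglement (fun z => (C * V) z j) + ∑ j, pureEntanglement (fun z => (C * W) z j)
  have hF : Continuous F := by
    refine Continuous.add (continuous_finsetSum _ fun j _ => continuous_pureEntanglement.comp ?_)
      (continuous_finsetSum _ fun j _ => continuous_pureEntanglement.comp ?_)
    · exact continuous_pi fun z => (continuous_id.matrix_mul continuous_const).matrix_elem z j
    · exact continuous_pi fun z => (continuous_id.matrix_mul continuous_const).matrix_elem z j
  have hF₀ : F C₀ < y := by
    refine lt_of_eq_of_lt ?_ hxy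
    simp only [F]
    rw [hCV, hCW]
    have h0 : pureEntanglement (fun _ : A × B => (0 : ℂ)) = 0 := by
      have : sqNorm (fun _ : A × B => (0 : ℂ)) = 0 := sqNorm_eq_zero.mpr rfl
      simp [pureEntanglement, this]
    simp only [Matrix.zero_apply, h0, Finset.sum_const_zero, add_zero]
    exact Finset.sum_congr rfl fun i _ => pureEntanglement_smul (hp i) (hψ i)
  filter_upwards [mem_nhdsWithin_of_mem_nhds (hF.continuousAt.eventually (gt_mem_nhds hF₀)),
    self_mem_nhdsWithin] with C hCF hC
  refine lt_of_le_of_lt ?_ hCF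
  have h := entanglementOfFormation_le_sum (ι := Fin N ⊕ A × B)
    (φ := Sum.elim (fun j z => (C * V) z j) (fun j z => (C * W) z j)) (ρ := C * C) ?_ hC.2
  · simpa [F, Fintype.sum_sum_type] using h
  · rw [Fintype.sum_sum_type]
    simp only [Sum.elim_inl, Sum.elim_inr]
    rw [sum_outer_col, sum_outer_col, conjTranspose_mul C V, conjTranspose_mul C W, hC.1.eq,
      Matrix.mul_assoc C V, ← Matrix.mul_assoc V, hV, Matrix.mul_assoc C W, ← Matrix.mul_assoc W,
      hWW, ← Matrix.mul_add, ← Matrix.add_mul]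
    simp [W]

theorem isClosed_isHermitian {I : Type*} :
    IsClosed {C : Matrix I I ℂ | C.IsHermitian} :=
  isClosed_eq continuous_id.matrix_conjTranspose continuous_id

theorem isCompact_isHermitian_trace_mul_self {I : Type*} [Fintype I] :
    IsCompact {C : Matrix I I ℂ | C.IsHermitian ∧ (C * C).trace = 1} := by
  have hcont : Continuous fun ψ : I × I → ℂ => (Matrix.of fun i j => ψ (i, j) : Matrix I I ℂ) :=
    continuous_matrix fun i j => continuous_apply (i, j)
  refine (isCompact_sqNorm_eq_one.image hcont).of_isClosed_subset
    (isClosed_isHermitian.inter ?_) ?_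
  · exact isClosed_eq (continuous_id.matrix_mul continuous_id).matrix_trace continuous_const
  · rintro C ⟨hC, h⟩
    refine ⟨fun q => C q.1 q.2, ?_, rfl⟩
    have h1 : ((sqNorm fun q : I × I => C q.1 q.2 : ℝ) : ℂ) = 1 := by
      rw [← h, sqNorm, Fintype.sum_prod_type, Complex.ofReal_sum, Matrix.trace]
      refine Finset.sum_congr rfl fun i _ => ?_
      rw [Complex.ofReal_sum, Matrix.diag_apply, Matrix.mul_apply]
      refine Finset.sum_congr rfl fun j _ => ?_
      rw [← Complex.mul_conj, ← hC.apply j i]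
      rfl
    exact_mod_cast h1

theorem isCompact_isDensityMatrix {I : Type*} [Fintype I] [DecidableEq I] :
    IsCompact {ρ : Matrix I I ℂ | IsDensityMatrix ρ} := by
  have h := (isCompact_isHermitian_trace_mul_self (I := I)).image
    (continuous_id.matrix_mul continuous_id)
  convert h using 1
  ext ρ
  constructor
  · rintro ⟨hρ, h1⟩
    obtain ⟨C, hC, rfl⟩ := hρ.exists_isHermitian_mul_self
    exact ⟨C, ⟨hC, h1⟩, rfl⟩
  · rintro ⟨C, ⟨hC, h1⟩, rfl⟩
    refine ⟨?_, h1⟩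
    have := posSemidef_self_mul_conjTranspose C
    rwa [hC.eq] at this

/-- Along a continuous family of density matrices over a nonempty compact set, the entanglement
of formation attains its maximum. -/
theorem exists_isMaxOn_entanglementOfFormation {X : Type*} [TopologicalSpace X] {s : Set X}
    (hs : IsCompact s) (hne : s.Nonempty) {r : X → Matrix (A × B) (A × B) ℂ}
    (hr : ContinuousOn r s) (hd : ∀ x ∈ s, IsDensityMatrix (r x)) :
    ∃ x ∈ s, ∀ y ∈ s, entanglementOfFormation (r y) ≤ entanglementOfFormation (r x) := by
  have hK : IsCompact (r '' s) := hs.image_of_continuousOn hr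
  have hT : IsCompact ({C : Matrix (A × B) (A × B) ℂ | C.IsHermitian ∧ (C * C).trace = 1} ∩
      (fun C => C * C) ⁻¹' (r '' s)) :=
    isCompact_isHermitian_trace_mul_self.inter_right
      (hK.isClosed.preimage (continuous_id.matrix_mul continuous_id))
  have hex : ∀ x ∈ s, ∃ C : Matrix (A × B) (A × B) ℂ,
      (C.IsHermitian ∧ (C * C).trace = 1) ∧ C * C = r x := fun x hx => by
    obtain ⟨C, hC, h⟩ := (hd x hx).1.exists_isHermitian_mul_self
    exact ⟨C, ⟨hC, h ▸ (hd x hx).2⟩, h⟩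
  obtain ⟨x₀, hx₀⟩ := hne
  obtain ⟨C₀, hC₀, hCx₀⟩ := hex x₀ hx₀
  have husc := (upperSemicontinuousOn_entanglementOfFormation_mul_self (A := A) (B := B)).mono
    (Set.inter_subset_left (t := (fun C => C * C) ⁻¹' (r '' s)))
  have hT₀ : C₀ ∈ {C : Matrix (A × B) (A × B) ℂ | C.IsHermitian ∧ (C * C).trace = 1} ∩
      (fun C => C * C) ⁻¹' (r '' s) := ⟨hC₀, x₀, hx₀, hCx₀.symm⟩
  obtain ⟨C, ⟨-, x, hx, hxC⟩, hmax⟩ := husc.exists_isMaxOn ⟨C₀, hT₀⟩ hT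
  refine ⟨x, hx, fun y hy => ?_⟩
  obtain ⟨D, hD, hDy⟩ := hex y hy
  have h : entanglementOfFormation (D * D) ≤ entanglementOfFormation (C * C) :=
    hmax (Set.mem_inter (show D ∈ {C | _} from hD) ⟨y, hy, hDy.symm⟩)
  rwa [hDy, ← show r x = C * C from hxC] at h

end Attainment

section GroundState

variable {I : Type*} [Fintype I] [DecidableEq I]

theorem lambdaMin_le_trace {M ρ : Matrix I I ℂ} (hM : M.IsHermitian) (hρ : IsDensityMatrix ρ) :
    lambdaMin M ≤ ((ρ * M).trace).re := by
  let U : Matrix I I ℂ := hM.eigenvectorUnitary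
  have hU : U * star U = 1 := Unitary.coe_mul_star_self _
  have hpos : (star U * ρ * U).PosSemidef := hρ.1.conjTranspose_mul_mul_same U
  have htr : (star U * ρ * U).trace = 1 := by
    rw [Matrix.trace_mul_cycle, hU, Matrix.one_mul, hρ.2]
  have hsum : ∑ i, ((star U * ρ * U) i i).re = 1 := by
    simpa [Matrix.trace] using congrArg Complex.re htr
  have hval : ((ρ * M).trace).re
      = ∑ i, ((star U * ρ * U) i i).re * hM.eigenvalues i := by
    have h : (ρ * M).trace
        = (star U * ρ * U * diagonal (fun i => (hM.eigenvalues i : ℂ))).trace := by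
      conv_lhs => rw [hM.eq_mul_diagonal_mul_star]
      change (ρ * (U * _ * star U)).trace = _
      rw [← Matrix.mul_assoc, Matrix.trace_mul_comm, ← Matrix.mul_assoc, ← Matrix.mul_assoc]
    rw [h]
    simp [Matrix.trace, mul_diagonal]
  rw [lambdaMin, dif_pos hM, hval]
  calc (⨅ i, hM.eigenvalues i)
      = ∑ i, ((star U * ρ * U) i i).re * ⨅ i, hM.eigenvalues i := by
        rw [← Finset.sum_mul, hsum, one_mul]
    _ ≤ _ := Finset.sum_le_sum fun i _ => mul_le_mul_of_nonneg_left
        (ciInf_le (Set.finite_range _).bddBelow i)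
        (Complex.le_def.mp (hpos.diag_nonneg (i := i))).1

theorem exists_trace_eq_lambdaMin [Nonempty I] {M : Matrix I I ℂ} (hM : M.IsHermitian) :
    ∃ ρ, IsDensityMatrix ρ ∧ ((ρ * M).trace).re = lambdaMin M := by
  obtain ⟨i, hi⟩ := exists_eq_ciInf_of_finite (f := hM.eigenvalues)
  let U : Matrix I I ℂ := hM.eigenvectorUnitary
  have hU : star U * U = 1 := Unitary.coe_star_mul_self _
  refine ⟨U * diagonal (Pi.single i 1) * star U, ⟨?_, ?_⟩, ?_⟩
  · refine PosSemidef.mul_mul_conjTranspose_same (PosSemidef.diagonal fun j => ?_) U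
    by_cases h : j = i
    · subst h; simp
    · simp [h]
  · rw [Matrix.trace_mul_cycle, hU, Matrix.one_mul, Matrix.trace_diagonal]
    simp
  · have h : U * diagonal (Pi.single i 1) * star U * M
        = U * diagonal (Pi.single i (hM.eigenvalues i : ℂ)) * star U := by
      conv_lhs => rw [hM.eq_mul_diagonal_mul_star]
      change U * _ * star U * (U * _ * star U) = _
      rw [← Matrix.mul_assoc, ← Matrix.mul_assoc, Matrix.mul_assoc (U * _) (star U) U, hU,
        Matrix.mul_one, Matrix.mul_assoc U, diagonal_mul_diagonal]
      congr 3
      funext j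
      by_cases h : j = i
      · subst h; simp
      · simp [h]
    rw [h, Matrix.trace_mul_cycle, hU, Matrix.one_mul, Matrix.trace_diagonal, lambdaMin,
      dif_pos hM, ← hi]
    simp

end GroundState

section Symmetry

variable {n d : ℕ}

/-- The relabelling of configurations induced by a permutation of the sites. -/
def relabel (d : ℕ) (g : Equiv.Perm (Fin n)) : Equiv.Perm (Fin n → Fin d) :=
  g⁻¹.arrowCongr (Equiv.refl _)

theorem relabel_apply (g : Equiv.Perm (Fin n)) (f : Fin n → Fin d) : relabel d g f = f ∘ g := rfl

theorem permMatrix_mul_mul_conjTranspose (g : Equiv.Perm (Fin n))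
    (M : Matrix (Fin n → Fin d) (Fin n → Fin d) ℂ) :
    permMatrix n d g * M * (permMatrix n d g)ᴴ = M.submatrix (relabel d g) (relabel d g) := by
  have hiff : ∀ f f' : Fin n → Fin d, f = f' ∘ ⇑(Equiv.symm g) ↔ f' = relabel d g f := by
    intro f f'
    constructor
    · rintro rfl
      funext k
      simp [relabel_apply]
    · rintro rfl
      funext k
      simp [relabel_apply]
  ext f f'
  simp [Matrix.mul_apply, permMatrix, hiff, apply_ite (starRingEnd ℂ)]

theorem submatrix_relabel_relabel (g g' : Equiv.Perm (Fin n))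
    (M : Matrix (Fin n → Fin d) (Fin n → Fin d) ℂ) :
    (M.submatrix (relabel d g') (relabel d g')).submatrix (relabel d g) (relabel d g)
      = M.submatrix (relabel d (g * g')) (relabel d (g * g')) := rfl

theorem trace_submatrix_relabel (g : Equiv.Perm (Fin n))
    (M : Matrix (Fin n → Fin d) (Fin n → Fin d) ℂ) :
    (M.submatrix (relabel d g) (relabel d g)).trace = M.trace :=
  Equiv.sum_comp (relabel d g) fun f => M f f

/-- Invariance under the action of the permutations in `G` by conjugation. -/
def IsPermInvariant (G : Subgroup (Equiv.Perm (Fin n)))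
    (M : Matrix (Fin n → Fin d) (Fin n → Fin d) ℂ) : Prop :=
  ∀ g ∈ G, permMatrix n d g * M * (permMatrix n d g)ᴴ = M

variable (G : Subgroup (Equiv.Perm (Fin n))) [Fintype G]

/-- The average of a matrix over the conjugates by `G`. -/
noncomputable def groupAverage (M : Matrix (Fin n → Fin d) (Fin n → Fin d) ℂ) :
    Matrix (Fin n → Fin d) (Fin n → Fin d) ℂ :=
  ((Fintype.card G : ℂ))⁻¹ • ∑ g : G, permMatrix n d g * M * (permMatrix n d g)ᴴ

theorem groupAverage_isPermInvariant (M : Matrix (Fin n → Fin d) (Fin n → Fin d) ℂ) :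
    IsPermInvariant G (groupAverage G M) := by
  intro g hg
  rw [groupAverage, Matrix.mul_smul, Matrix.smul_mul, Matrix.mul_sum, Matrix.sum_mul]
  refine congrArg _ (Fintype.sum_equiv (Equiv.mulLeft (⟨g, hg⟩ : G)) _ _ fun g' => ?_)
  rw [Equiv.coe_mulLeft, Subgroup.coe_mul, permMatrix_mul_mul_conjTranspose,
    permMatrix_mul_mul_conjTranspose, permMatrix_mul_mul_conjTranspose,
    submatrix_relabel_relabel]

theorem trace_groupAverage_mul (M : Matrix (Fin n → Fin d) (Fin n → Fin d) ℂ)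
    {N : Matrix (Fin n → Fin d) (Fin n → Fin d) ℂ} (hN : IsPermInvariant G N) :
    (groupAverage G M * N).trace = (M * N).trace := by
  have h : ∀ g : G, (permMatrix n d g * M * (permMatrix n d g)ᴴ * N).trace = (M * N).trace := by
    intro g
    conv_lhs => rw [← hN g g.2]
    rw [permMatrix_mul_mul_conjTranspose, permMatrix_mul_mul_conjTranspose, submatrix_mul_equiv,
      trace_submatrix_relabel]
  rw [groupAverage, Matrix.smul_mul, Matrix.sum_mul, Matrix.trace_smul, Matrix.trace_sum,
    Finset.sum_congr rfl fun g _ => h g, Finset.sum_const, Finset.card_univ, nsmul_eq_mul,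
    smul_eq_mul, inv_mul_cancel_left₀ (Nat.cast_ne_zero.mpr Fintype.card_ne_zero)]

theorem groupAverage_isDensityMatrix {ρ : Matrix (Fin n → Fin d) (Fin n → Fin d) ℂ}
    (hρ : IsDensityMatrix ρ) : IsDensityMatrix (groupAverage G ρ) := by
  have h := IsDensityMatrix.convex_sum (ι := G) (p := fun _ => (Fintype.card G : ℝ)⁻¹)
    (ρ := fun g => permMatrix n d g * ρ * (permMatrix n d g)ᴴ) (fun _ => by positivity)
    (by simp) fun g => ⟨hρ.1.mul_mul_conjTranspose_same _, by
      rw [permMatrix_mul_mul_conjTranspose, trace_submatrix_relabel, hρ.2]⟩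
  rw [groupAverage, Finset.smul_sum]
  simpa using h

theorem groupAverage_isHermitian {M : Matrix (Fin n → Fin d) (Fin n → Fin d) ℂ}
    (hM : M.IsHermitian) : (groupAverage G M).IsHermitian := by
  have h : ∀ g : G, (permMatrix n d g * M * (permMatrix n d g)ᴴ)ᴴ
      = permMatrix n d g * M * (permMatrix n d g)ᴴ := fun g =>
    isHermitian_mul_mul_conjTranspose _ hM
  simp [IsHermitian, groupAverage, conjTranspose_smul, conjTranspose_sum, h, -conjTranspose_mul]

end Symmetry

section TwoSite

variable {n d : ℕ} (hn : 2 ≤ n)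

theorem twoSiteObs_isHermitian {h : Matrix (Fin d × Fin d) (Fin d × Fin d) ℂ}
    (hh : h.IsHermitian) : (twoSiteObs n d hn h).IsHermitian := by
  ext f f'
  simp only [conjTranspose_apply, twoSiteObs, of_apply, apply_ite (star : ℂ → ℂ), star_zero,
    hh.apply]
  refine if_congr ?_ rfl rfl
  exact forall₂_congr fun _ _ => eq_comm

theorem twoSiteObs_one : twoSiteObs n d hn 1 = 1 := by
  ext f f'
  simp only [twoSiteObs, of_apply, Matrix.one_apply, ← ite_and]
  refine if_congr ?_ rfl rfl
  constructor
  · rintro ⟨h2, h01⟩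
    rw [Prod.mk.injEq] at h01
    funext ⟨k, hk⟩
    match k with
    | 0 => exact h01.1
    | 1 => exact h01.2
    | k + 2 => exact h2 _ (by simp)
  · rintro rfl
    simp

theorem twoSiteReduced_apply (ρ : Matrix (Fin n → Fin d) (Fin n → Fin d) ℂ)
    (x y : Fin d × Fin d) :
    twoSiteReduced n d hn ρ x y = ∑ f, ∑ f', if ∀ k : Fin n, 2 ≤ (k : ℕ) → f k = f' k then
      if (f ⟨0, by omega⟩, f ⟨1, by omega⟩) = x then
        if (f' ⟨0, by omega⟩, f' ⟨1, by omega⟩) = y then ρ f f' else 0 else 0 else 0 := by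
  rw [twoSiteReduced, of_apply, Finset.sum_filter, Fintype.sum_prod_type]
  refine Finset.sum_congr rfl fun f _ => Finset.sum_congr rfl fun f' _ => ?_
  simp only [← ite_and, Prod.ext_iff]
  exact if_congr (by tauto) rfl rfl

theorem trace_twoSiteReduced_mul (ρ : Matrix (Fin n → Fin d) (Fin n → Fin d) ℂ)
    (h : Matrix (Fin d × Fin d) (Fin d × Fin d) ℂ) :
    (twoSiteReduced n d hn ρ * h).trace = (ρ * twoSiteObs n d hn h).trace := by
  simp only [Matrix.trace, Matrix.diag_apply, Matrix.mul_apply, twoSiteReduced_apply,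
    Finset.sum_mul]
  rw [Finset.sum_congr rfl fun x _ => Finset.sum_comm, Finset.sum_comm]
  refine Finset.sum_congr rfl fun f _ => ?_
  rw [Finset.sum_congr rfl fun x _ => Finset.sum_comm, Finset.sum_comm]
  refine Finset.sum_congr rfl fun f' _ => ?_
  by_cases hff : ∀ k : Fin n, 2 ≤ (k : ℕ) → f k = f' k
  · have hff' : ∀ k : Fin n, 2 ≤ (k : ℕ) → f' k = f k := fun k hk => (hff k hk).symm
    simp only [twoSiteObs, of_apply, if_pos hff, if_pos hff']
    simp [ite_mul]
  · have hff' : ¬ ∀ k : Fin n, 2 ≤ (k : ℕ) → f' k = f k := fun h =>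
      hff fun k hk => (h k hk).symm
    simp only [twoSiteObs, of_apply, if_neg hff, if_neg hff']
    simp

/-- The operator `1 ⊗ ⟨r|` onto the first two sites, for a configuration `r` of the others. -/
def restSelector (r : {k : Fin n // 2 ≤ (k : ℕ)} → Fin d) :
    Matrix (Fin d × Fin d) (Fin n → Fin d) ℂ :=
  Matrix.of fun x f =>
    if r = (fun k => f k.1) ∧ (f ⟨0, by omega⟩, f ⟨1, by omega⟩) = x then 1 else 0

theorem twoSiteReduced_eq_sum (ρ : Matrix (Fin n → Fin d) (Fin n → Fin d) ℂ) :
    twoSiteReduced n d hn ρ = ∑ r : {k : Fin n // 2 ≤ (k : ℕ)} → Fin d,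
      restSelector hn r * ρ * (restSelector hn r)ᴴ := by
  ext x y
  simp only [Matrix.sum_apply, Matrix.mul_apply, twoSiteReduced_apply, Finset.sum_mul,
    conjTranspose_apply]
  refine Eq.symm (Finset.sum_comm.trans (Eq.trans ?_ Finset.sum_comm))
  refine Finset.sum_congr rfl fun f' _ => Finset.sum_comm.trans ?_
  refine Finset.sum_congr rfl fun f _ => ?_
  have hiff : (∀ k : Fin n, 2 ≤ (k : ℕ) → f k = f' k) ↔
      (fun k : {k : Fin n // 2 ≤ (k : ℕ)} => f' k.1) = fun k => f k.1 := by
    simp [funext_iff, eq_comm]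
  simp only [restSelector, of_apply, hiff, ite_and]
  simp only [apply_ite (star : ℂ → ℂ), star_one, star_zero, ite_mul, mul_ite, one_mul, mul_one,
    zero_mul, mul_zero, Finset.sum_ite_eq', Finset.mem_univ, if_true]
  simp only [← ite_and]
  exact if_congr (by tauto) rfl rfl

theorem IsDensityMatrix.twoSiteReduced {ρ : Matrix (Fin n → Fin d) (Fin n → Fin d) ℂ}
    (hρ : IsDensityMatrix ρ) : IsDensityMatrix (twoSiteReduced n d hn ρ) := by
  refine ⟨?_, ?_⟩
  · rw [twoSiteReduced_eq_sum]
    exact posSemidef_sum _ fun r _ => hρ.1.mul_mul_conjTranspose_same _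
  · rw [← Matrix.mul_one (_root_.twoSiteReduced n d hn ρ), trace_twoSiteReduced_mul,
      twoSiteObs_one, Matrix.mul_one, hρ.2]

theorem continuous_twoSiteReduced : Continuous (twoSiteReduced n d hn) := by
  refine continuous_matrix fun x y => ?_
  exact continuous_finsetSum _ fun ff _ => continuous_id.matrix_elem _ _

theorem avgHam_eq_groupAverage (G : Subgroup (Equiv.Perm (Fin n))) [Fintype G]
    (h : Matrix (Fin d × Fin d) (Fin d × Fin d) ℂ) :
    avgHam n d hn G h = groupAverage G (twoSiteObs n d hn h) := rfl

theorem trace_mul_avgHam (G : Subgroup (Equiv.Perm (Fin n))) [Fintype G]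
    {ρ : Matrix (Fin n → Fin d) (Fin n → Fin d) ℂ} (hρ : IsPermInvariant G ρ)
    (h : Matrix (Fin d × Fin d) (Fin d × Fin d) ℂ) :
    (ρ * avgHam n d hn G h).trace = (twoSiteReduced n d hn ρ * h).trace := by
  rw [avgHam_eq_groupAverage, Matrix.trace_mul_comm, trace_groupAverage_mul G _ hρ,
    Matrix.trace_mul_comm, trace_twoSiteReduced_mul]

theorem avgHam_isHermitian (G : Subgroup (Equiv.Perm (Fin n))) [Fintype G]
    {h : Matrix (Fin d × Fin d) (Fin d × Fin d) ℂ} (hh : h.IsHermitian) :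
    (avgHam n d hn G h).IsHermitian :=
  groupAverage_isHermitian G (twoSiteObs_isHermitian hn hh)

theorem exists_isPermInvariant_trace_eq_lambdaMin [Nonempty (Fin n → Fin d)]
    (G : Subgroup (Equiv.Perm (Fin n))) [Fintype G]
    {h : Matrix (Fin d × Fin d) (Fin d × Fin d) ℂ} (hh : h.IsHermitian) :
    ∃ ρ, IsDensityMatrix ρ ∧ IsPermInvariant G ρ ∧
      ((twoSiteReduced n d hn ρ * h).trace).re = lambdaMin (avgHam n d hn G h) := by
  obtain ⟨ρ, hρ, hval⟩ := exists_trace_eq_lambdaMin (avgHam_isHermitian hn G hh)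
  have hinv : IsPermInvariant G (avgHam n d hn G h) := groupAverage_isPermInvariant G _
  refine ⟨groupAverage G ρ, groupAverage_isDensityMatrix G hρ, groupAverage_isPermInvariant G ρ, ?_⟩
  rw [← trace_mul_avgHam hn G (groupAverage_isPermInvariant G ρ),
    trace_groupAverage_mul G ρ hinv, hval]

theorem isClosed_isPermInvariant (G : Subgroup (Equiv.Perm (Fin n))) :
    IsClosed {ρ : Matrix (Fin n → Fin d) (Fin n → Fin d) ℂ | IsPermInvariant G ρ} := by
  simp only [IsPermInvariant, Set.ofPred_forall]
  exact isClosed_iInter fun g => isClosed_iInter fun _ => isClosed_eq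
    ((continuous_const.matrix_mul continuous_id).matrix_mul continuous_const) continuous_id

end TwoSite

/-- The maximal entanglement of formation between two sites of a globally symmetric
multipartite state equals minus the infimum of ground state energies of the
corresponding group-averaged nearest-neighbor Hamiltonians; moreover the supremum
is attained by some `G`-invariant density matrix. -/
theorem max_eof_eq_neg_inf_ground_state_energy
    (n d : ℕ) (hn : 2 ≤ n) (hd : 1 ≤ d)
    (G : Subgroup (Equiv.Perm (Fin n))) [Fintype G] :
    IsGreatest
      {x : ℝ | ∃ ρ : Matrix (Fin n → Fin d) (Fin n → Fin d) ℂ,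
        IsDensityMatrix ρ ∧
        (∀ g ∈ G, permMatrix n d g * ρ * (permMatrix n d g)ᴴ = ρ) ∧
        x = entanglementOfFormation (twoSiteReduced n d hn ρ)}
      (- sInf {e : ℝ | ∃ h : Matrix (Fin d × Fin d) (Fin d × Fin d) ℂ,
        h.IsHermitian ∧
        (∀ σ : Matrix (Fin d × Fin d) (Fin d × Fin d) ℂ, IsDensityMatrix σ →
          0 ≤ ((σ * h).trace).re + vonNeumannEntropy (ptraceA σ)) ∧
        e = lambdaMin (avgHam n d hn G h)}) := by
  have : Nonempty (Fin n → Fin d) := ⟨fun _ => ⟨0, hd⟩⟩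
  let K := {ρ : Matrix (Fin n → Fin d) (Fin n → Fin d) ℂ | IsDensityMatrix ρ} ∩
    {ρ | IsPermInvariant G ρ}
  have hK : IsCompact K := isCompact_isDensityMatrix.inter_right (isClosed_isPermInvariant G)
  obtain ⟨ρ₀, hρ₀, hinv₀, -⟩ :=
    exists_isPermInvariant_trace_eq_lambdaMin hn G (isHermitian_zero (n := Fin d × Fin d) (α := ℂ))
  obtain ⟨ρ, ⟨hρ, hinv⟩, hmax⟩ := exists_isMaxOn_entanglementOfFormation hK
    ⟨ρ₀, hρ₀, hinv₀⟩ (continuous_twoSiteReduced hn).continuousOn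
    fun ρ hρ => IsDensityMatrix.twoSiteReduced hn hρ.1
  have hnearby : ∀ y < entanglementOfFormation (twoSiteReduced n d hn ρ),
      ∃ h : Matrix (Fin d × Fin d) (Fin d × Fin d) ℂ, h.IsHermitian ∧
        (∀ σ : Matrix (Fin d × Fin d) (Fin d × Fin d) ℂ, IsDensityMatrix σ →
          0 ≤ ((σ * h).trace).re + vonNeumannEntropy (ptraceA σ)) ∧
        lambdaMin (avgHam n d hn G h) < -y := by
    intro y hy
    obtain ⟨h, hh, hfeas, hlt⟩ := exists_dual_witness (hρ.twoSiteReduced hn) hy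
    refine ⟨h, hh, hfeas, ?_⟩
    have hle := lambdaMin_le_trace (avgHam_isHermitian hn G hh) hρ
    rw [trace_mul_avgHam hn G hinv] at hle
    linarith
  have hlower : ∀ h : Matrix (Fin d × Fin d) (Fin d × Fin d) ℂ, h.IsHermitian →
      (∀ σ : Matrix (Fin d × Fin d) (Fin d × Fin d) ℂ, IsDensityMatrix σ →
        0 ≤ ((σ * h).trace).re + vonNeumannEntropy (ptraceA σ)) →
      -entanglementOfFormation (twoSiteReduced n d hn ρ) ≤ lambdaMin (avgHam n d hn G h) := by
    intro h hh hfeas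
    obtain ⟨τ, hτ, hτinv, hval⟩ := exists_isPermInvariant_trace_eq_lambdaMin hn G hh
    have h1 := neg_trace_le_entanglementOfFormation hfeas (hτ.twoSiteReduced hn)
    have h2 := hmax τ ⟨hτ, hτinv⟩
    linarith
  have hinf : sInf {e : ℝ | ∃ h : Matrix (Fin d × Fin d) (Fin d × Fin d) ℂ,
      h.IsHermitian ∧
      (∀ σ : Matrix (Fin d × Fin d) (Fin d × Fin d) ℂ, IsDensityMatrix σ →
        0 ≤ ((σ * h).trace).re + vonNeumannEntropy (ptraceA σ)) ∧
      e = lambdaMin (avgHam n d hn G h)}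
      = -entanglementOfFormation (twoSiteReduced n d hn ρ) := by
    refine csInf_eq_of_forall_ge_of_forall_gt_exists_lt ?_ ?_ ?_
    · obtain ⟨h, hh, hfeas, -⟩ := hnearby _ (sub_one_lt _)
      exact ⟨_, h, hh, hfeas, rfl⟩
    · rintro _ ⟨h, hh, hfeas, rfl⟩
      exact hlower h hh hfeas
    · intro w hw
      obtain ⟨h, hh, hfeas, hlt⟩ := hnearby (-w) (by linarith)
      exact ⟨_, ⟨h, hh, hfeas, rfl⟩, by rwa [neg_neg] at hlt⟩
  rw [hinf, neg_neg]
  refine ⟨⟨ρ, hρ, hinv, rfl⟩, ?_⟩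
  rintro _ ⟨τ, hτ, hτinv, rfl⟩
  exact hmax τ ⟨hτ, hτinv⟩
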